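/- Let m be a positive integer with q ≡ 1 (mod 2m), let a, b ∈ F_q^× with a ≠ b, and let χ be a multiplicative character of F_q of order 2m. Then the number of affine points #{(x,y) ∈ F_q × F_q : y² = (x^m + a)(x^m + b)} equals q + ψ_{(m,m)}(a,b), and the number of affine points #{(x,y) ∈ F_q × F_q : y² = x·(x^m + a)(x^m + b)} equals q + φ_{(m,m)}(a,b), where moreover φ_{(m,m)}(a,b) = q·φ(−ab)·Σ_{k=0}^{m−1} χ^{2k+1}(−a)·₂F₁(φ, χ^{2k+1}; χ^{2k+1+m} | a/b). -/

import Mathlib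

/-- The quadratic character of a finite field, as a `ℂ`-valued multiplicative character. -/
noncomputable def quadCharℂ (F : Type*) [Field F] [Fintype F] [DecidableEq F] : MulChar F ℂ :=
  (quadraticChar F).ringHomComp (Int.castRingHom ℂ)

/-- Greene's Gaussian hypergeometric series `₂F₁(A,B;C | x)` over the finite field `F`:
`₂F₁(A,B;C | x) = (C(−1)/(q(q−1))) · ∑_ψ J(Aψ, ψ⁻¹)·J(Bψ, C⁻¹ψ⁻¹)·ψ(x)`,
the sum running over all multiplicative characters `ψ` of `F`,
where `J(A,B) = ∑_x A(x)·B(1−x)` is the Jacobi sum. -/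
noncomputable def gauss2F1 {F : Type*} [Field F] [Fintype F]
    (A B C : MulChar F ℂ) (x : F) : ℂ :=
  haveI : Fintype (MulChar F ℂ) := Fintype.ofFinite _
  C (-1) / ((Fintype.card F : ℂ) * ((Fintype.card F : ℂ) - 1)) *
    ∑ ψ : MulChar F ℂ, jacobiSum (A * ψ) ψ⁻¹ * jacobiSum (B * ψ) (C⁻¹ * ψ⁻¹) * ψ x

open Finset

lemma quadCharℂ_apply {F : Type*} [Field F] [Fintype F] [DecidableEq F] (x : F) :
    quadCharℂ F x = (quadraticChar F x : ℂ) := rfl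

lemma quadCharℂ_inv (F : Type*) [Field F] [Fintype F] [DecidableEq F] :
    (quadCharℂ F)⁻¹ = quadCharℂ F :=
  ((quadraticChar_isQuadratic F).comp _).inv

/-- The number of affine points of `y² = f(x)` in terms of the quadratic character. -/
lemma card_affine_points_sq_eq {F : Type*} [Field F] [Fintype F] [DecidableEq F]
    (hF : ringChar F ≠ 2) (f : F → F) :
    ((univ.filter (fun P : F × F => P.2 ^ 2 = f P.1)).card : ℂ) =
      (Fintype.card F : ℂ) + ∑ x : F, quadCharℂ F (f x) := by
  have h (x : F) : (∑ y : F, if y ^ 2 = f x then (1 : ℂ) else 0) = quadCharℂ F (f x) + 1 := by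
    have h := congrArg (Int.cast : ℤ → ℂ) (quadraticChar_card_sqrts hF (f x))
    rw [Set.toFinset_ofPred] at h
    rw [quadCharℂ_apply, sum_boole]
    exact_mod_cast h
  rw [card_filter, Nat.cast_sum, Fintype.sum_prod_type]
  simp only [Nat.cast_ite, Nat.cast_one, Nat.cast_zero, h, sum_add_distrib, sum_const, card_univ,
    nsmul_eq_mul, mul_one]
  exact add_comm _ _

/-- Orthogonality: the sum of the values at `a` of all characters of a finite field. -/
lemma MulChar.sum_apply_eq {F : Type*} [Field F] [Fintype F] [DecidableEq F]
    [Fintype (MulChar F ℂ)] (a : F) :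
    ∑ ψ : MulChar F ℂ, ψ a = if a = 1 then (Fintype.card F : ℂ) - 1 else 0 := by
  split_ifs with ha
  · have h := MulChar.card_eq_card_units_of_hasEnoughRootsOfUnity F ℂ
    rw [Nat.card_eq_fintype_card, Nat.card_eq_fintype_card, Fintype.card_units] at h
    simp [ha, h, Nat.cast_sub Fintype.card_pos]
  · obtain ⟨χ, hχ⟩ := MulChar.exists_apply_ne_one_of_hasEnoughRootsOfUnity F ℂ ha
    refine eq_zero_of_mul_eq_self_left hχ ?_
    simp only [mul_sum, ← MulChar.mul_apply]
    exact Fintype.sum_bijective _ (Group.mulLeft_bijective χ) _ _ fun χ' ↦ rfl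

/-- Greene's integral-type representation of the finite field `₂F₁`. -/
lemma gauss2F1_eq_sum {F : Type*} [Field F] [Fintype F] (A B C : MulChar F ℂ) {x : F}
    (hx : x ≠ 0) :
    gauss2F1 A B C x = C (-1) / (Fintype.card F : ℂ) *
      ∑ v : F, B v * (A * C⁻¹) (1 - v) * A⁻¹ (1 - v + v * x) := by
  classical
  let _ : Fintype (MulChar F ℂ) := Fintype.ofFinite _
  have hexp : ∑ ψ : MulChar F ℂ, jacobiSum (A * ψ) ψ⁻¹ * jacobiSum (B * ψ) (C⁻¹ * ψ⁻¹) * ψ x =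
      ∑ v : F, ∑ u : F, A u * B v * C⁻¹ (1 - v) *
        ∑ ψ : MulChar F ℂ, ψ (u * (1 - u)⁻¹ * (v * (1 - v)⁻¹) * x) := by
    simp only [jacobiSum, mul_sum, sum_mul]
    rw [sum_comm]
    refine sum_congr rfl fun u _ => ?_
    rw [sum_comm]
    refine sum_congr rfl fun v _ => sum_congr rfl fun ψ _ => ?_
    simp only [MulChar.mul_apply, MulChar.inv_apply', map_mul]
    ring
  have hinner (v : F) : (∑ u : F, A u * B v * C⁻¹ (1 - v) *
        ∑ ψ : MulChar F ℂ, ψ (u * (1 - u)⁻¹ * (v * (1 - v)⁻¹) * x)) =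
      ((Fintype.card F : ℂ) - 1) * (B v * (A * C⁻¹) (1 - v) * A⁻¹ (1 - v + v * x)) := by
    simp only [MulChar.sum_apply_eq]
    by_cases hv0 : v = 0
    · simp [hv0, B.map_zero]
    by_cases hv1 : 1 - v = 0
    · simp [hv1, A.map_zero]
    have hiff (u : F) : u * (1 - u)⁻¹ * (v * (1 - v)⁻¹) * x = 1 ↔
        u * (1 - v + v * x) = 1 - v := by
      by_cases hu : 1 - u = 0
      · have : u = 1 := (sub_eq_zero.mp hu).symm
        simp [this, hv0, hx]
      · field_simp
        constructor <;> intro h <;> linear_combination h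
    simp only [hiff]
    by_cases hd : 1 - v + v * x = 0
    · simp [hd, Ne.symm hv1, A⁻¹.map_zero]
    · rw [sum_eq_single ((1 - v) * (1 - v + v * x)⁻¹)]
      · rw [if_pos (by field_simp)]
        simp only [MulChar.mul_apply, MulChar.inv_apply', map_mul]
        ring
      · intro u _ hu
        rw [if_neg fun h => hu ((eq_mul_inv_iff_mul_eq₀ hd).mpr h), mul_zero]
      · simp
  have hq : (Fintype.card F : ℂ) - 1 ≠ 0 := by
    rw [sub_ne_zero]
    exact_mod_cast (Fintype.one_lt_card (α := F)).ne'
  have hq0 : (Fintype.card F : ℂ) ≠ 0 := by exact_mod_cast Fintype.card_ne_zero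
  unfold gauss2F1
  rw [hexp, sum_congr rfl fun v _ => hinner v, ← mul_sum]
  generalize ∑ v : F, B v * (A * C⁻¹) (1 - v) * A⁻¹ (1 - v + v * x) = S
  field_simp

/-- The shape of `₂F₁(φ, B; Bφ | a/b)` as a character sum twisted by `B`. -/
lemma gauss2F1_quadCharℂ_eq_sum {F : Type*} [Field F] [Fintype F] [DecidableEq F]
    (B : MulChar F ℂ) {a b : F} (ha : a ≠ 0) (hb : b ≠ 0) :
    (Fintype.card F : ℂ) * quadCharℂ F (-(a * b)) *
        (B (-a) * gauss2F1 (quadCharℂ F) B (B * quadCharℂ F) (a / b)) =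
      ∑ t : F, B t * quadCharℂ F (t + a) * quadCharℂ F (t + b) := by
  set φ := quadCharℂ F with hφ
  have hφinv : φ⁻¹ = φ := quadCharℂ_inv F
  have hφsq {x : F} (hx : x ≠ 0) : φ x * φ x = 1 := by
    rw [← φ.mul_apply]
    nth_rw 1 [← hφinv]
    rw [inv_mul_cancel, MulChar.one_apply hx.isUnit]
  have hq0 : (Fintype.card F : ℂ) ≠ 0 := by exact_mod_cast Fintype.card_ne_zero
  have hφC : φ * (B * φ)⁻¹ = B⁻¹ := by
    rw [mul_inv, mul_comm, mul_assoc, inv_mul_cancel, mul_one]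
  have hneg : φ (-1) * φ (-1) = 1 := hφsq (neg_ne_zero.mpr one_ne_zero)
  have hBneg : B (-a) * B (-1) = B a := by rw [← map_mul]; simp
  have hmain : φ (a * b) * B a *
        ∑ v : F, B v * B⁻¹ (1 - v) * φ (1 - v + v * (a / b)) =
      ∑ t : F, B t * φ (t + a) * φ (t + b) := by
    rw [mul_sum, ← sum_filter_of_ne (p := fun v : F => v ≠ 1),
      ← sum_filter_of_ne (s := univ) (p := fun t : F => t ≠ -a)]
    · refine sum_bij' (fun v _ => a * v * (1 - v)⁻¹) (fun t _ => t * (t + a)⁻¹) ?_ ?_ ?_ ?_ ?_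
      · intro v hv
        have hv : 1 - v ≠ 0 := sub_ne_zero.mpr (Ne.symm (by simpa using hv))
        simp only [mem_filter_univ]
        intro h
        have : a * (1 - v)⁻¹ = 0 := by
          rw [show a * (1 - v)⁻¹ = a * v * (1 - v)⁻¹ + a by field_simp; ring, h, neg_add_cancel]
        exact mul_ne_zero ha (inv_ne_zero hv) this
      · intro t ht
        have ht : t + a ≠ 0 := fun h => (by simpa using ht : t ≠ -a) (eq_neg_of_add_eq_zero_left h)
        simp only [mem_filter_univ]
        intro h
        exact ha (by simpa using (mul_inv_eq_one₀ ht).mp h)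
      · intro v hv
        have hv : 1 - v ≠ 0 := sub_ne_zero.mpr (Ne.symm (by simpa using hv))
        have : a * v * (1 - v)⁻¹ + a = a * (1 - v)⁻¹ := by field_simp; ring
        simp only [this]
        field_simp
      · intro t ht
        have ht : t + a ≠ 0 := fun h => (by simpa using ht : t ≠ -a) (eq_neg_of_add_eq_zero_left h)
        have : 1 - t * (t + a)⁻¹ = a * (t + a)⁻¹ := by field_simp; ring
        simp only [this]
        field_simp
      · intro v hv
        have hv : 1 - v ≠ 0 := sub_ne_zero.mpr (Ne.symm (by simpa using hv))
        have h1 : a * v * (1 - v)⁻¹ + a = a * (1 - v)⁻¹ := by field_simp; ring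
        have h2 : a * v * (1 - v)⁻¹ + b = b * (1 - v + v * (a / b)) * (1 - v)⁻¹ := by
          field_simp; ring
        have h3 := hφsq (inv_ne_zero hv)
        simp only [h1, h2, map_mul, MulChar.inv_apply']
        linear_combination -(φ a * φ b * B a * B v * B (1 - v)⁻¹ *
          φ (1 - v + v * (a / b))) * h3
    · rintro t - h rfl
      simp [φ.map_zero] at h
    · rintro v - h rfl
      simp [B⁻¹.map_zero] at h
  rw [gauss2F1_eq_sum _ _ _ (div_ne_zero ha hb), hφC, hφinv, ← hmain, ← hBneg,
    MulChar.mul_apply, neg_eq_neg_one_mul (a * b), map_mul φ (-1)]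
  generalize ∑ v : F, B v * B⁻¹ (1 - v) * φ (1 - v + v * (a / b)) = S
  field_simp
  linear_combination φ (a * b) * B (-a) * B (-1) * S * hneg

/-- If `g` generates the units, then `χ g` is a primitive root of unity of order `orderOf χ`. -/
lemma MulChar.isPrimitiveRoot_apply_generator {F : Type*} [Field F] {g : Fˣ}
    (hg : ∀ x, x ∈ Subgroup.zpowers g) (χ : MulChar F ℂ) :
    IsPrimitiveRoot (χ g) (orderOf χ) where
  pow_eq_one := by
    rw [← MulChar.pow_apply_coe, pow_orderOf_eq_one, MulChar.one_apply_coe]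
  dvd_of_pow_eq_one l hl := by
    apply orderOf_dvd_of_pow_eq_one
    rw [MulChar.eq_iff hg, MulChar.pow_apply_coe, hl, MulChar.one_apply_coe]

/-- A character of order `2m` raised to the `m`-th power is the quadratic character. -/
lemma MulChar.pow_eq_quadCharℂ {F : Type*} [Field F] [Fintype F] [DecidableEq F]
    (hF : ringChar F ≠ 2) {m : ℕ} (hm : 0 < m) {χ : MulChar F ℂ} (hχ : orderOf χ = 2 * m) :
    χ ^ m = quadCharℂ F := by
  obtain ⟨g, hg⟩ := IsCyclic.exists_generator (α := Fˣ)
  have key {ψ : MulChar F ℂ} (h1 : ψ ≠ 1) (h2 : ψ ^ 2 = 1) : ψ g = -1 := by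
    have h : ψ g ^ 2 = 1 := by rw [← MulChar.pow_apply_coe, h2, MulChar.one_apply_coe]
    refine (sq_eq_one_iff.mp h).resolve_left fun h => h1 ?_
    rw [MulChar.eq_iff hg, h, MulChar.one_apply_coe]
  rw [MulChar.eq_iff hg, key, key]
  · exact (MulChar.ringHomComp_ne_one_iff (RingHom.injective_int _)).mpr (quadraticChar_ne_one hF)
  · exact ((quadraticChar_isQuadratic F).comp _).sq_eq_one
  · exact pow_ne_one_of_lt_orderOf hm.ne' (by omega)
  · rw [← pow_mul, mul_comm, ← hχ, pow_orderOf_eq_one]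

/-- In a finite field with `m ∣ q - 1`, a nonzero `m`-th power has exactly `m` roots. -/
lemma FiniteField.card_filter_pow_eq {F : Type*} [Field F] [Fintype F] [DecidableEq F]
    {m : ℕ} (hm : 0 < m) (hdvd : m ∣ Fintype.card F - 1) {y : F} (hy : y ≠ 0) :
    (univ.filter (fun x : F => x ^ m = y ^ m)).card = m := by
  obtain ⟨g, hg⟩ := IsCyclic.exists_ofOrder_eq_natCard (α := Fˣ)
  rw [Nat.card_eq_fintype_card, Fintype.card_units] at hg
  obtain ⟨c, hc⟩ := hdvd
  have hq : 0 < Fintype.card F - 1 := Nat.sub_pos_of_lt Fintype.one_lt_card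
  have hprim : IsPrimitiveRoot (g : F) (Fintype.card F - 1) :=
    IsPrimitiveRoot.coe_units_iff.mpr (hg ▸ IsPrimitiveRoot.orderOf g)
  have hζ := hprim.pow hq (hc.trans (mul_comm m c))
  have hnodup := hζ.nthRoots_nodup (pow_ne_zero m hy)
  rw [show univ.filter (fun x : F => x ^ m = y ^ m) = (Polynomial.nthRoots m (y ^ m)).toFinset by
    ext x; simp [Polynomial.mem_nthRoots hm], Multiset.toFinset_card_of_nodup hnodup,
    hζ.card_nthRoots, if_pos ⟨y, rfl⟩]

/-- The quadratic character summed over the `m`-th roots of `t`. -/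
lemma sum_quadCharℂ_filter_pow_eq {F : Type*} [Field F] [Fintype F] [DecidableEq F]
    (hF : ringChar F ≠ 2) {m : ℕ} (hm : 0 < m) (hdvd : m ∣ Fintype.card F - 1)
    {χ : MulChar F ℂ} (hχ : orderOf χ = 2 * m) (t : F) :
    ∑ x ∈ univ.filter (fun x : F => x ^ m = t), quadCharℂ F x =
      ∑ k ∈ range m, (χ ^ (2 * k + 1)) t := by
  have hφ := MulChar.pow_eq_quadCharℂ hF hm hχ
  have hval {x : F} (hx : x ^ m = t) : quadCharℂ F x = χ t := by
    rw [← hφ, MulChar.pow_apply' _ hm.ne', ← map_pow, hx]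
  rw [sum_congr rfl fun x hx => hval (mem_filter.mp hx).2, sum_const, nsmul_eq_mul]
  have hpow (k : ℕ) : (χ ^ (2 * k + 1)) t = χ t * (χ t ^ 2) ^ k := by
    rw [MulChar.pow_apply' _ (by omega)]
    ring
  simp only [hpow, ← mul_sum]
  by_cases ht : t = 0
  · simp [ht, χ.map_zero]
  by_cases hex : ∃ y, y ^ m = t
  · obtain ⟨y, rfl⟩ := hex
    have hy : y ≠ 0 := fun h => ht (by simp [h, hm.ne'])
    have hsq : χ (y ^ m) ^ 2 = 1 := by
      rw [← hval rfl, quadCharℂ_apply]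
      exact_mod_cast quadraticChar_sq_one hy
    rw [FiniteField.card_filter_pow_eq hm hdvd hy]
    simp only [hsq, one_pow, sum_const, card_range, nsmul_eq_mul, mul_one]
    exact mul_comm _ _
  · have hempty : univ.filter (fun x : F => x ^ m = t) = ∅ :=
      filter_eq_empty_iff.mpr fun x _ hx => hex ⟨x, hx⟩
    obtain ⟨g, hg⟩ := IsCyclic.exists_generator (α := Fˣ)
    have hprim := χ.isPrimitiveRoot_apply_generator hg
    rw [hχ] at hprim
    obtain ⟨j, hj⟩ := mem_powers_iff_mem_zpowers.mpr (hg (Units.mk0 t ht))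
    have hgt : (g : F) ^ j = t := by simpa using congrArg Units.val hj
    have hne : χ t ^ 2 ≠ 1 := by
      intro h
      rw [← hgt, map_pow, ← pow_mul, mul_comm] at h
      obtain ⟨c, rfl⟩ := Nat.dvd_of_mul_dvd_mul_left two_pos (hprim.dvd_of_pow_eq_one _ h)
      exact hex ⟨(g : F) ^ c, by rw [← hgt, ← pow_mul, mul_comm]⟩
    have hone : (χ t ^ 2) ^ m = 1 := by
      rw [← pow_mul, ← hgt, map_pow, pow_right_comm, hprim.pow_eq_one, one_pow]
    rw [hempty, geom_sum_eq hne, hone]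
    simp

/-- Let `F = F_q` with `q` odd, `φ` its quadratic character, `m ≥ 1` with
`q ≡ 1 (mod 2m)`, `a, b ∈ F_q^×` with `a ≠ b`, and `χ` a multiplicative character of order
`2m`. Then the number of affine points of `y² = (xᵐ + a)(xᵐ + b)` equals
`q + ψ_{(m,m)}(a,b)`, the number of affine points of `y² = x(xᵐ + a)(xᵐ + b)` equals
`q + φ_{(m,m)}(a,b)`, and moreover
`φ_{(m,m)}(a,b) = q·φ(−ab)·∑_{k=0}^{m−1} χ^{2k+1}(−a)·₂F₁(φ, χ^{2k+1}; χ^{2k+1+m} | a/b)`. -/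
theorem affine_points_hyperelliptic_xm
    {F : Type*} [Field F] [Fintype F] [DecidableEq F]
    (hq : Odd (Fintype.card F)) (m : ℕ) (hm : 0 < m)
    (hqm : Fintype.card F % (2 * m) = 1)
    (a b : F) (ha : a ≠ 0) (hb : b ≠ 0) (hab : a ≠ b)
    (χ : MulChar F ℂ) (hχ : orderOf χ = 2 * m) :
    (((Finset.univ.filter
          (fun P : F × F => P.2 ^ 2 = (P.1 ^ m + a) * (P.1 ^ m + b))).card : ℂ) =
        (Fintype.card F : ℂ) +
          ∑ x : F, (quadCharℂ F) (x ^ m + a) * (quadCharℂ F) (x ^ m + b)) ∧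
      (((Finset.univ.filter
          (fun P : F × F => P.2 ^ 2 = P.1 * (P.1 ^ m + a) * (P.1 ^ m + b))).card : ℂ) =
        (Fintype.card F : ℂ) +
          ∑ x : F, (quadCharℂ F) x * (quadCharℂ F) (x ^ m + a) * (quadCharℂ F) (x ^ m + b)) ∧
      (∑ x : F, (quadCharℂ F) x * (quadCharℂ F) (x ^ m + a) * (quadCharℂ F) (x ^ m + b)) =
        (Fintype.card F : ℂ) * (quadCharℂ F) (-(a * b)) *
          ∑ k ∈ Finset.range m, (χ ^ (2 * k + 1)) (-a) *
            gauss2F1 (quadCharℂ F) (χ ^ (2 * k + 1)) (χ ^ (2 * k + 1 + m)) (a / b) := by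
  have hF : ringChar F ≠ 2 := fun h => by
    have := FiniteField.even_card_of_char_two h
    have := Nat.odd_iff.mp hq
    omega
  have hdvd : m ∣ Fintype.card F - 1 :=
    (Dvd.intro_left 2 rfl).trans ((Nat.modEq_iff_dvd' Fintype.card_pos).mp (by
      rw [Nat.ModEq, hqm, Nat.mod_eq_of_lt (by omega)]))
  have hφ := MulChar.pow_eq_quadCharℂ hF hm hχ
  refine ⟨?_, ?_, ?_⟩
  · rw [card_affine_points_sq_eq hF (fun x => (x ^ m + a) * (x ^ m + b))]
    simp only [map_mul]
  · rw [card_affine_points_sq_eq hF (fun x => x * (x ^ m + a) * (x ^ m + b))]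
    simp only [map_mul]
  · simp only [pow_add χ _ m, hφ]
    rw [mul_sum, sum_congr rfl fun k _ => gauss2F1_quadCharℂ_eq_sum (χ ^ (2 * k + 1)) ha hb,
      sum_comm, ← sum_fiberwise univ (fun x : F => x ^ m)]
    refine sum_congr rfl fun t _ => ?_
    rw [← sum_mul, ← sum_mul, ← sum_quadCharℂ_filter_pow_eq hF hm hdvd hχ t, sum_mul, sum_mul]
    refine sum_congr rfl fun x hx => ?_
    rw [(mem_filter.mp hx).2]
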